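/- Let (X_t)_{t∈ℕ} be a 1-approximating functional with constants (a_k)_{k≥0} of a stationary absolutely regular time series with mixing coefficients (β_k)_{k≥0}, with E X_0 = 0, and suppose for a fixed integer d ≥ 0 either (i) X_0 is a.s. bounded and Σ_{k=d}^∞ k²(a_k + β_k) < ∞, or (ii) E|X_0|^{4+δ} < ∞ for some δ > 0 and Σ_{k=d}^∞ k²(a_k^{δ/(3+δ)} + β_k^{δ/(4+δ)}) < ∞. Then there exists a constant C > 0 such that E S_n⁴ ≤ C n² for all n, where S_n = X_1 + … + X_n. -/

import Mathlib

open MeasureTheory ProbabilityTheory Filter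

noncomputable section

/-- The σ-algebra 𝒜ₖˡ = σ(Z_k, …, Z_l). -/
def sigmaIcc {Ω : Type*} [MeasurableSpace Ω] (Z : ℤ → Ω → ℝ) (k l : ℤ) : MeasurableSpace Ω :=
  ⨆ i ∈ Set.Icc k l, MeasurableSpace.comap (Z i) inferInstance

/-- The σ-algebra 𝒜ₖ^∞ = σ(Z_k, Z_{k+1}, …). -/
def sigmaIci {Ω : Type*} [MeasurableSpace Ω] (Z : ℤ → Ω → ℝ) (k : ℤ) : MeasurableSpace Ω :=
  ⨆ i ∈ Set.Ici k, MeasurableSpace.comap (Z i) inferInstance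

/-- A stationary time series. -/
def Stationary {Ω : Type*} [MeasurableSpace Ω] (μ : Measure Ω) (Z : ℤ → Ω → ℝ) : Prop :=
  ∀ t : ℤ, Measure.map (fun ω => fun s : ℤ => Z (s + t) ω) μ
    = Measure.map (fun ω => fun s : ℤ => Z s ω) μ

/-- The absolute-regularity coefficient of two σ-algebras:
`sup Σ_i Σ_j |P(A_i ∩ B_j) − P(A_i)P(B_j)|` over all finite measurable partitions. -/
def betaCoeff {Ω : Type*} [MeasurableSpace Ω] (μ : Measure Ω)
    (m₁ m₂ : MeasurableSpace Ω) : ℝ :=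
  sSup {r : ℝ | ∃ (I J : ℕ) (A : Fin I → Set Ω) (B : Fin J → Set Ω),
    (∀ i, MeasurableSet[m₁] (A i)) ∧ (∀ j, MeasurableSet[m₂] (B j)) ∧
    Pairwise (Function.onFun Disjoint A) ∧ Pairwise (Function.onFun Disjoint B) ∧
    (⋃ i, A i) = Set.univ ∧ (⋃ j, B j) = Set.univ ∧
    r = ∑ i, ∑ j, |(μ (A i ∩ B j)).toReal - (μ (A i)).toReal * (μ (B j)).toReal|}

/-- The mixing coefficient `β_k = sup_n β(σ(Z_1,…,Z_n), σ(Z_{n+k},…))`. -/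
def betaMix {Ω : Type*} [MeasurableSpace Ω] (μ : Measure Ω) (Z : ℤ → Ω → ℝ) (k : ℕ) : ℝ :=
  sSup {r : ℝ | ∃ n : ℕ, 1 ≤ n ∧ r = betaCoeff μ (sigmaIcc Z 1 n) (sigmaIci Z (n + k))}

section BetaPart

lemma partition_sum_le {Ω : Type*} [mΩ : MeasurableSpace Ω] (μ : Measure Ω) [IsProbabilityMeasure μ]
    {I J : Type} [Fintype I] [Fintype J] (A : I → Set Ω) (B : J → Set Ω)
    (hA : ∀ i, MeasurableSet (A i)) (hB : ∀ j, MeasurableSet (B j))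
    (dA : Pairwise (Function.onFun Disjoint A)) (dB : Pairwise (Function.onFun Disjoint B))
    (uA : (⋃ i, A i) = Set.univ) (uB : (⋃ j, B j) = Set.univ) :
    ∑ i, ∑ j, |(μ (A i ∩ B j)).toReal - (μ (A i)).toReal * (μ (B j)).toReal| ≤ 2 := by
  have key : ∀ {K : Type} [Fintype K] (D : K → Set Ω), (∀ i, MeasurableSet (D i)) →
      Pairwise (Function.onFun Disjoint D) → (⋃ i, D i) = Set.univ → ∀ S : Set Ω,
      MeasurableSet S → ∑ j, (μ (S ∩ D j)).toReal = (μ S).toReal := by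
    intro K _ D hD dD uD S hS
    have h := measureReal_iUnion_fintype (μ := μ) (f := fun j => S ∩ D j)
      (fun i j hij => ((dD hij).mono Set.inter_subset_right Set.inter_subset_right))
      (fun j => hS.inter (hD j))
    rw [← Set.inter_iUnion, uD, Set.inter_univ] at h
    exact h.symm
  have hA1 : ∑ i, (μ (A i)).toReal = 1 := by
    have := key A hA dA uA Set.univ MeasurableSet.univ
    simpa using this
  have hB1 : ∑ j, (μ (B j)).toReal = 1 := by
    have := key B hB dB uB Set.univ MeasurableSet.univ
    simpa using this
  calc ∑ i, ∑ j, |(μ (A i ∩ B j)).toReal - (μ (A i)).toReal * (μ (B j)).toReal|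
      ≤ ∑ i, ∑ j, ((μ (A i ∩ B j)).toReal + (μ (A i)).toReal * (μ (B j)).toReal) := by
        refine Finset.sum_le_sum fun i _ => Finset.sum_le_sum fun j _ => ?_
        have h1 : 0 ≤ (μ (A i ∩ B j)).toReal := ENNReal.toReal_nonneg
        have h2 : 0 ≤ (μ (A i)).toReal * (μ (B j)).toReal := by positivity
        rw [abs_le]; constructor <;> linarith
    _ = 2 := by
        simp_rw [Finset.sum_add_distrib, ← Finset.mul_sum, hB1]
        rw [Finset.sum_congr rfl (fun i _ => key B hB dB uB (A i) (hA i)), ← Finset.sum_mul, hA1]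
        norm_num

lemma le_betaCoeff {Ω : Type*} (m₁ m₂ : MeasurableSpace Ω) [mΩ : MeasurableSpace Ω] (μ : Measure Ω) [IsProbabilityMeasure μ] (h₁ : m₁ ≤ mΩ) (h₂ : m₂ ≤ mΩ)
    {I J : Type} [Fintype I] [Fintype J] (A : I → Set Ω) (B : J → Set Ω)
    (hA : ∀ i, MeasurableSet[m₁] (A i)) (hB : ∀ j, MeasurableSet[m₂] (B j))
    (dA : Pairwise (Function.onFun Disjoint A)) (dB : Pairwise (Function.onFun Disjoint B))
    (uA : (⋃ i, A i) = Set.univ) (uB : (⋃ j, B j) = Set.univ) :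
    ∑ i, ∑ j, |(μ (A i ∩ B j)).toReal - (μ (A i)).toReal * (μ (B j)).toReal|
      ≤ betaCoeff μ m₁ m₂ := by
  refine le_csSup ⟨2, ?_⟩ ?_
  · rintro r ⟨I, J, A, B, hA, hB, dA, dB, uA, uB, rfl⟩
    exact partition_sum_le μ A B (fun i => h₁ _ (hA i)) (fun i => h₂ _ (hB i)) dA dB uA uB
  · let eI := Fintype.equivFin I
    let eJ := Fintype.equivFin J
    refine ⟨Fintype.card I, Fintype.card J, fun i => A (eI.symm i), fun j => B (eJ.symm j),
      fun i => hA _, fun j => hB _, fun i j hij => dA (eI.symm.injective.ne hij),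
      fun i j hij => dB (eJ.symm.injective.ne hij), ?_, ?_, ?_⟩
    · rw [← uA]; exact eI.symm.surjective.iUnion_comp A
    · rw [← uB]; exact eJ.symm.surjective.iUnion_comp B
    · rw [← Equiv.sum_comp eI.symm]
      refine Finset.sum_congr rfl fun i _ => ?_
      rw [← Equiv.sum_comp eJ.symm]

lemma betaCoeff_le_two {Ω : Type*} (m₁ m₂ : MeasurableSpace Ω) [mΩ : MeasurableSpace Ω] (μ : Measure Ω)
    [IsProbabilityMeasure μ] (h₁ : m₁ ≤ mΩ) (h₂ : m₂ ≤ mΩ) :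
    betaCoeff μ m₁ m₂ ≤ 2 := by
  refine Real.sSup_le ?_ (by norm_num)
  rintro r ⟨I, J, A, B, hA, hB, dA, dB, uA, uB, rfl⟩
  exact partition_sum_le μ A B (fun i => h₁ _ (hA i)) (fun i => h₂ _ (hB i)) dA dB uA uB

lemma betaCoeff_nonneg {Ω : Type*} (m₁ m₂ : MeasurableSpace Ω) [mΩ : MeasurableSpace Ω] (μ : Measure Ω) : 0 ≤ betaCoeff μ m₁ m₂ := by
  refine Real.sSup_nonneg ?_
  rintro r ⟨I, J, A, B, hA, hB, dA, dB, uA, uB, rfl⟩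
  positivity

lemma betaMix_nonneg {Ω : Type*} [mΩ : MeasurableSpace Ω] (μ : Measure Ω) (Z : ℤ → Ω → ℝ)
    (k : ℕ) : 0 ≤ betaMix μ Z k := by
  refine Real.sSup_nonneg ?_
  rintro r ⟨n, hn, rfl⟩
  exact betaCoeff_nonneg _ _ μ

lemma sigmaIcc_le {Ω : Type*} [mΩ : MeasurableSpace Ω] (Z : ℤ → Ω → ℝ)
    (hZ : ∀ t, Measurable (Z t)) (k l : ℤ) : sigmaIcc Z k l ≤ mΩ :=
  iSup₂_le fun i _ => (hZ i).comap_le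

lemma sigmaIci_le {Ω : Type*} [mΩ : MeasurableSpace Ω] (Z : ℤ → Ω → ℝ)
    (hZ : ∀ t, Measurable (Z t)) (k : ℤ) : sigmaIci Z k ≤ mΩ :=
  iSup₂_le fun i _ => (hZ i).comap_le

lemma betaCoeff_le_betaMix {Ω : Type*} [mΩ : MeasurableSpace Ω] (μ : Measure Ω)
    [IsProbabilityMeasure μ] (Z : ℤ → Ω → ℝ) (hZ : ∀ t, Measurable (Z t)) (k n : ℕ) (hn : 1 ≤ n) :
    betaCoeff μ (sigmaIcc Z 1 n) (sigmaIci Z (n + k)) ≤ betaMix μ Z k := by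
  refine le_csSup ⟨2, ?_⟩ ⟨n, hn, rfl⟩
  rintro r ⟨n, hn, rfl⟩
  exact betaCoeff_le_two _ _ μ (sigmaIcc_le Z hZ _ _) (sigmaIci_le Z hZ _)

lemma simple_cov {Ω : Type*} (m₁ m₂ : MeasurableSpace Ω) [mΩ : MeasurableSpace Ω] (μ : Measure Ω) [IsProbabilityMeasure μ] (h₁ : m₁ ≤ mΩ) (h₂ : m₂ ≤ mΩ)
    (U : @SimpleFunc Ω m₁ ℝ) (V : @SimpleFunc Ω m₂ ℝ) (a b : ℝ) (ha : ∀ ω, |U ω| ≤ a)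
    (hb : ∀ ω, |V ω| ≤ b) :
    |∫ ω, U ω * V ω ∂μ - (∫ ω, U ω ∂μ) * (∫ ω, V ω ∂μ)| ≤ a * b * betaCoeff μ m₁ m₂ := by
  classical
  let I := @SimpleFunc.range _ _ m₁ U
  let J := @SimpleFunc.range _ _ m₂ V
  let A : I → Set Ω := fun x => U ⁻¹' {x.1}
  let B : J → Set Ω := fun x => V ⁻¹' {x.1}
  have hA : ∀ i, MeasurableSet[m₁] (A i) := fun i => @SimpleFunc.measurableSet_fiber _ _ m₁ U i
  have hB : ∀ i, MeasurableSet[m₂] (B i) := fun i => @SimpleFunc.measurableSet_fiber _ _ m₂ V i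
  have hA' := fun i => h₁ _ (hA i)
  have hB' := fun i => h₂ _ (hB i)
  have dA : Pairwise (Function.onFun Disjoint A) := by
    intro i j hij
    refine Set.disjoint_left.2 fun ω h h' => hij (Subtype.ext ?_)
    exact (show U ω = i.1 from h).symm.trans (show U ω = j.1 from h')
  have dB : Pairwise (Function.onFun Disjoint B) := by
    intro i j hij
    refine Set.disjoint_left.2 fun ω h h' => hij (Subtype.ext ?_)
    exact (show V ω = i.1 from h).symm.trans (show V ω = j.1 from h')
  have memI : ∀ ω, U ω ∈ I := fun ω => (@SimpleFunc.mem_range _ _ m₁ U _).2 ⟨ω, rfl⟩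
  have memJ : ∀ ω, V ω ∈ J := fun ω => (@SimpleFunc.mem_range _ _ m₂ V _).2 ⟨ω, rfl⟩
  have uA : (⋃ i, A i) = Set.univ :=
    Set.eq_univ_of_forall fun ω => Set.mem_iUnion.2 ⟨⟨U ω, memI ω⟩, rfl⟩
  have uB : (⋃ i, B i) = Set.univ :=
    Set.eq_univ_of_forall fun ω => Set.mem_iUnion.2 ⟨⟨V ω, memJ ω⟩, rfl⟩
  have eU : ∀ ω, U ω = ∑ i : I, (A i).indicator (fun _ => i.1) ω := by
    intro ω
    rw [Finset.sum_eq_single (⟨U ω, memI ω⟩ : I)]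
    · rw [Set.indicator_of_mem]; rfl
    · intro i _ hi
      rw [Set.indicator_of_notMem]
      intro h; exact hi (Subtype.ext (show U ω = i.1 from h).symm)
    · simp
  have eV : ∀ ω, V ω = ∑ i : J, (B i).indicator (fun _ => i.1) ω := by
    intro ω
    rw [Finset.sum_eq_single (⟨V ω, memJ ω⟩ : J)]
    · rw [Set.indicator_of_mem]; rfl
    · intro i _ hi
      rw [Set.indicator_of_notMem]
      intro h; exact hi (Subtype.ext (show V ω = i.1 from h).symm)
    · simp
  have iU : ∫ ω, U ω ∂μ = ∑ i : I, (μ (A i)).toReal * i.1 := by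
    simp_rw [eU]
    rw [integral_finsetSum _ fun i _ => (integrable_const _).indicator (hA' i)]
    refine Finset.sum_congr rfl fun i _ => ?_
    rw [integral_indicator_const _ (hA' i)]; rfl
  have iV : ∫ ω, V ω ∂μ = ∑ i : J, (μ (B i)).toReal * i.1 := by
    simp_rw [eV]
    rw [integral_finsetSum _ fun i _ => (integrable_const _).indicator (hB' i)]
    refine Finset.sum_congr rfl fun i _ => ?_
    rw [integral_indicator_const _ (hB' i)]; rfl
  have iUV : ∫ ω, U ω * V ω ∂μ = ∑ i : I, ∑ j : J, (μ (A i ∩ B j)).toReal * (i.1 * j.1) := by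
    have : ∀ ω, U ω * V ω = ∑ i : I, ∑ j : J, (A i ∩ B j).indicator (fun _ => i.1 * j.1) ω := by
      intro ω
      rw [eU, eV, Finset.sum_mul_sum]
      refine Finset.sum_congr rfl fun i _ => Finset.sum_congr rfl fun j _ => ?_
      by_cases h : ω ∈ A i <;> by_cases h' : ω ∈ B j <;> simp [h, h']
    simp_rw [this]
    rw [integral_finsetSum _ fun i _ => integrable_finsetSum _ fun j _ =>
      (integrable_const _).indicator ((hA' i).inter (hB' j))]
    refine Finset.sum_congr rfl fun i _ => ?_
    rw [integral_finsetSum _ fun j _ =>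
      (integrable_const _).indicator ((hA' i).inter (hB' j))]
    refine Finset.sum_congr rfl fun j _ => ?_
    rw [integral_indicator_const _ ((hA' i).inter (hB' j))]; rfl
  have a0 : 0 ≤ a := by
    obtain ⟨ω⟩ : Nonempty Ω := by
      by_contra h
      rw [not_nonempty_iff] at h
      have := measure_univ (μ := μ)
      rw [Set.univ_eq_empty_iff.2 h] at this
      simp at this
    exact (abs_nonneg _).trans (ha ω)
  rw [iU, iV, iUV, Finset.sum_mul_sum, ← Finset.sum_sub_distrib]
  simp_rw [← Finset.sum_sub_distrib]
  calc _ ≤ ∑ i : I, ∑ j : J, |(μ (A i ∩ B j)).toReal * (i.1 * j.1) -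
          (μ (A i)).toReal * i.1 * ((μ (B j)).toReal * j.1)| :=
        (Finset.abs_sum_le_sum_abs _ _).trans
          (Finset.sum_le_sum fun i _ => Finset.abs_sum_le_sum_abs _ _)
    _ ≤ ∑ i : I, ∑ j : J, a * b * |(μ (A i ∩ B j)).toReal -
          (μ (A i)).toReal * (μ (B j)).toReal| := by
        refine Finset.sum_le_sum fun i _ => Finset.sum_le_sum fun j _ => ?_
        obtain ⟨ω, hω⟩ := (@SimpleFunc.mem_range _ _ m₁ U _).1 i.2
        obtain ⟨ω', hω'⟩ := (@SimpleFunc.mem_range _ _ m₂ V _).1 j.2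
        have h1 : |i.1| ≤ a := hω ▸ ha ω
        have h2 : |j.1| ≤ b := hω' ▸ hb ω'
        have : (μ (A i ∩ B j)).toReal * (i.1 * j.1) -
          (μ (A i)).toReal * i.1 * ((μ (B j)).toReal * j.1) = i.1 * j.1 * ((μ (A i ∩ B j)).toReal -
          (μ (A i)).toReal * (μ (B j)).toReal) := by ring
        rw [this, abs_mul, abs_mul]
        gcongr
    _ ≤ a * b * betaCoeff μ m₁ m₂ := by
        simp_rw [← Finset.mul_sum]
        have b0 : 0 ≤ b := by
          obtain ⟨ω⟩ : Nonempty Ω := by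
            by_contra h
            rw [not_nonempty_iff] at h
            have := measure_univ (μ := μ)
            rw [Set.univ_eq_empty_iff.2 h] at this
            simp at this
          exact (abs_nonneg _).trans (hb ω)
        gcongr
        exact le_betaCoeff m₁ m₂ μ h₁ h₂ A B hA hB dA dB uA uB

lemma cov_le {Ω : Type*} (m₁ m₂ : MeasurableSpace Ω) [mΩ : MeasurableSpace Ω] (μ : Measure Ω) [IsProbabilityMeasure μ] (h₁ : m₁ ≤ mΩ) (h₂ : m₂ ≤ mΩ)
    (U V : Ω → ℝ) (hU : Measurable[m₁] U) (hV : Measurable[m₂] V)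
    (a b : ℝ) (ha0 : 0 ≤ a) (hb0 : 0 ≤ b) (ha : ∀ ω, |U ω| ≤ a)
    (hb : ∀ ω, |V ω| ≤ b) :
    |∫ ω, U ω * V ω ∂μ - (∫ ω, U ω ∂μ) * (∫ ω, V ω ∂μ)| ≤ a * b * betaCoeff μ m₁ m₂ := by
  have z1 : (0 : ℝ) ∈ Set.Icc (-a) a := ⟨by linarith, ha0⟩
  have z2 : (0 : ℝ) ∈ Set.Icc (-b) b := ⟨by linarith, hb0⟩
  let Un := fun n => @SimpleFunc.approxOn _ _ _ _ _ m₁ U hU (Set.Icc (-a) a) 0 z1 _ n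
  let Vn := fun n => @SimpleFunc.approxOn _ _ _ _ _ m₂ V hV (Set.Icc (-b) b) 0 z2 _ n
  have bU : ∀ n ω, |Un n ω| ≤ a := fun n ω =>
    abs_le.2 (@SimpleFunc.approxOn_mem _ _ _ _ _ m₁ U hU _ 0 z1 _ n ω)
  have bV : ∀ n ω, |Vn n ω| ≤ b := fun n ω =>
    abs_le.2 (@SimpleFunc.approxOn_mem _ _ _ _ _ m₂ V hV _ 0 z2 _ n ω)
  have tU : ∀ ω, Tendsto (fun n => Un n ω) atTop (nhds (U ω)) := fun ω =>
    @SimpleFunc.tendsto_approxOn _ _ _ _ _ m₁ U hU _ 0 z1 _ ω (subset_closure (abs_le.1 (ha ω)))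
  have tV : ∀ ω, Tendsto (fun n => Vn n ω) atTop (nhds (V ω)) := fun ω =>
    @SimpleFunc.tendsto_approxOn _ _ _ _ _ m₂ V hV _ 0 z2 _ ω (subset_closure (abs_le.1 (hb ω)))
  have mU : ∀ n, Measurable (Un n) := fun n => (@SimpleFunc.measurable _ _ m₁ _ (Un n)).mono h₁ le_rfl
  have mV : ∀ n, Measurable (Vn n) := fun n => (@SimpleFunc.measurable _ _ m₂ _ (Vn n)).mono h₂ le_rfl
  have l1 : Tendsto (fun n => ∫ ω, Un n ω ∂μ) atTop (nhds (∫ ω, U ω ∂μ)) :=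
    tendsto_integral_of_dominated_convergence (fun _ => a)
      (fun n => (mU n).aestronglyMeasurable) (integrable_const _)
      (fun n => ae_of_all _ fun ω => bU n ω) (ae_of_all _ tU)
  have l2 : Tendsto (fun n => ∫ ω, Vn n ω ∂μ) atTop (nhds (∫ ω, V ω ∂μ)) :=
    tendsto_integral_of_dominated_convergence (fun _ => b)
      (fun n => (mV n).aestronglyMeasurable) (integrable_const _)
      (fun n => ae_of_all _ fun ω => bV n ω) (ae_of_all _ tV)
  have l3 : Tendsto (fun n => ∫ ω, Un n ω * Vn n ω ∂μ) atTop (nhds (∫ ω, U ω * V ω ∂μ)) :=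
    tendsto_integral_of_dominated_convergence (fun _ => a * b)
      (fun n => ((mU n).mul (mV n)).aestronglyMeasurable) (integrable_const _)
      (fun n => ae_of_all _ fun ω => by
        rw [Real.norm_eq_abs, abs_mul]
        exact mul_le_mul (bU n ω) (bV n ω) (abs_nonneg _) ha0)
      (ae_of_all _ fun ω => (tU ω).mul (tV ω))
  exact le_of_tendsto (l3.sub (l1.mul l2)).abs
    (Eventually.of_forall fun n => simple_cov m₁ m₂ μ h₁ h₂ (Un n) (Vn n) a b (bU n) (bV n))

end BetaPart

section ClipPart

/-- Truncation to `[-N, N]`. -/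
def clipR (N x : ℝ) : ℝ := max (-N) (min N x)

/-- The fourth-power tail. -/
def tailR (N x : ℝ) : ℝ := if N < |x| then x ^ 4 else 0

lemma clipR_of_le {N x : ℝ} (h : |x| ≤ N) : clipR N x = x := by
  rw [abs_le] at h
  rw [clipR, min_eq_right h.2, max_eq_right h.1]

lemma abs_clipR_le {N : ℝ} (hN : 0 ≤ N) (x : ℝ) : |clipR N x| ≤ N :=
  abs_le.2 ⟨le_max_left _ _, max_le (by linarith) (min_le_left _ _)⟩

lemma abs_clipR_le_abs {N : ℝ} (hN : 0 ≤ N) (x : ℝ) : |clipR N x| ≤ |x| := by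
  rcases le_or_gt |x| N with h | h
  · rw [clipR_of_le h]
  · exact (abs_clipR_le hN x).trans h.le

lemma abs_clipR_sub_le (N x y : ℝ) : |clipR N x - clipR N y| ≤ |x - y| := by
  have h1 := abs_max_sub_max_le_max (-N) (min N x) (-N) (min N y)
  have h2 := abs_min_sub_min_le_max N x N y
  simp only [sub_self, abs_zero] at h1 h2
  rw [max_eq_right (abs_nonneg (min N x - min N y))] at h1
  rw [max_eq_right (abs_nonneg (x - y))] at h2
  exact h1.trans h2

lemma measurable_clipR (N : ℝ) : Measurable (clipR N) := by
  unfold clipR; fun_prop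

lemma measurable_tailR (N : ℝ) : Measurable (tailR N) := by
  unfold tailR
  exact Measurable.ite (measurableSet_lt measurable_const (by fun_prop)) (by fun_prop) (by fun_prop)

lemma tailR_nonneg (N x : ℝ) : 0 ≤ tailR N x := by
  unfold tailR; split_ifs
  · positivity
  · exact le_rfl

lemma tailR_le (N x : ℝ) : tailR N x ≤ x ^ 4 := by
  unfold tailR; split_ifs
  · exact le_rfl
  · positivity

lemma abs_prod_le_of_max (y : Fin 4 → ℝ) (c : ℝ) (h : ∀ i, |y i| ≤ c) : |∏ i, y i| ≤ c ^ 4 := by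
  rw [Finset.abs_prod]
  calc ∏ i, |y i| ≤ ∏ _i : Fin 4, c := Finset.prod_le_prod (fun i _ => abs_nonneg _) fun i _ => h i
    _ = c ^ 4 := by simp

lemma abs_prod_le_sum (y : Fin 4 → ℝ) : |∏ i, y i| ≤ ∑ i, (y i) ^ 4 := by
  obtain ⟨j, -, hj⟩ := Finset.exists_max_image Finset.univ (fun i => |y i|) Finset.univ_nonempty
  refine (abs_prod_le_of_max y _ fun i => hj i (Finset.mem_univ i)).trans ?_
  rw [Even.pow_abs (by decide)]
  exact Finset.single_le_sum (f := fun i => y i ^ 4) (fun i _ => by positivity) (Finset.mem_univ j)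

lemma prod_clip_sub {N : ℝ} (hN : 0 ≤ N) (y : Fin 4 → ℝ) :
    |∏ i, y i - ∏ i, clipR N (y i)| ≤ 2 * ∑ i, tailR N (y i) := by
  by_cases h : ∀ i, |y i| ≤ N
  · rw [Finset.prod_congr rfl fun i _ => clipR_of_le (h i), sub_self, abs_zero]
    exact mul_nonneg (by norm_num) (Finset.sum_nonneg fun i _ => tailR_nonneg _ _)
  · push Not at h
    obtain ⟨k, hk⟩ := h
    obtain ⟨j, -, hj⟩ := Finset.exists_max_image Finset.univ (fun i => |y i|) Finset.univ_nonempty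
    have hj' : ∀ i, |y i| ≤ |y j| := fun i => hj i (Finset.mem_univ i)
    have hNj : N < |y j| := hk.trans_le (hj' k)
    have h1 := abs_prod_le_of_max y _ hj'
    have h2 := abs_prod_le_of_max (fun i => clipR N (y i)) _
      (fun i => (abs_clipR_le_abs hN (y i)).trans (hj' i))
    have h3 : |y j| ^ 4 = tailR N (y j) := by
      rw [tailR, if_pos hNj, Even.pow_abs (by decide)]
    have h4 : tailR N (y j) ≤ ∑ i, tailR N (y i) :=
      Finset.single_le_sum (f := fun i => tailR N (y i)) (fun i _ => tailR_nonneg _ _)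
        (Finset.mem_univ j)
    have h5 := abs_sub (∏ i, y i) (∏ i, clipR N (y i))
    linarith

lemma abs_mul4_le {a b c d N D : ℝ} (ha : |a| ≤ D) (hb : |b| ≤ N) (hc : |c| ≤ N) (hd : |d| ≤ N) :
    |a * b * c * d| ≤ N ^ 3 * D := by
  have hN : 0 ≤ N := (abs_nonneg _).trans hb
  have hD : 0 ≤ D := (abs_nonneg _).trans ha
  rw [abs_mul, abs_mul, abs_mul]
  calc |a| * |b| * |c| * |d| ≤ D * N * N * N := by gcongr
    _ = N ^ 3 * D := by ring

lemma prod_sub_prod_le {N : ℝ} (c w : Fin 4 → ℝ) (hc : ∀ i, |c i| ≤ N) (hw : ∀ i, |w i| ≤ N) :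
    |∏ i, c i - ∏ i, w i| ≤ N ^ 3 * ∑ i, |c i - w i| := by
  simp only [Fin.prod_univ_four, Fin.sum_univ_four]
  have e : c 0 * c 1 * c 2 * c 3 - w 0 * w 1 * w 2 * w 3
    = (c 0 - w 0) * c 1 * c 2 * c 3 + (c 1 - w 1) * w 0 * c 2 * c 3
      + (c 2 - w 2) * w 0 * w 1 * c 3 + (c 3 - w 3) * w 0 * w 1 * w 2 := by ring
  rw [e]
  have h0 := abs_mul4_le (le_refl |c 0 - w 0|) (hc 1) (hc 2) (hc 3)
  have h1 := abs_mul4_le (le_refl |c 1 - w 1|) (hw 0) (hc 2) (hc 3)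
  have h2 := abs_mul4_le (le_refl |c 2 - w 2|) (hw 0) (hw 1) (hc 3)
  have h3 := abs_mul4_le (le_refl |c 3 - w 3|) (hw 0) (hw 1) (hw 2)
  refine (abs_add_le _ _).trans ?_
  have := abs_add_three ((c 0 - w 0) * c 1 * c 2 * c 3) ((c 1 - w 1) * w 0 * c 2 * c 3)
    ((c 2 - w 2) * w 0 * w 1 * c 3)
  linarith

lemma pointwise4 {N : ℝ} (hN : 0 ≤ N) (y w : Fin 4 → ℝ) :
    |∏ i, y i - ∏ i, clipR N (w i)| ≤ ∑ i, (2 * tailR N (y i) + N ^ 3 * |y i - w i|) := by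
  have h1 := prod_clip_sub hN y
  have h2 := prod_sub_prod_le (fun i => clipR N (y i)) (fun i => clipR N (w i))
    (fun i => abs_clipR_le hN _) (fun i => abs_clipR_le hN _)
  have h3 : ∑ i, |clipR N (y i) - clipR N (w i)| ≤ ∑ i, |y i - w i| :=
    Finset.sum_le_sum fun i _ => abs_clipR_sub_le _ _ _
  have h4 := abs_sub_le (∏ i, y i) (∏ i, clipR N (y i)) (∏ i, clipR N (w i))
  have h5 := mul_le_mul_of_nonneg_left h3 (pow_nonneg hN 3)
  rw [Finset.sum_add_distrib, ← Finset.mul_sum, ← Finset.mul_sum]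
  linarith

lemma integrable_prod4 {Ω : Type*} [MeasurableSpace Ω] (ν : Measure Ω) (Y : Fin 4 → Ω → ℝ)
    (hY : ∀ i, Measurable (Y i)) (hY4 : ∀ i, Integrable (fun ω => Y i ω ^ 4) ν) :
    Integrable (fun ω => ∏ i, Y i ω) ν := by
  refine (integrable_finsetSum Finset.univ fun i _ => hY4 i).mono'
    (Finset.measurable_prod _ fun i _ => hY i).aestronglyMeasurable (ae_of_all _ fun ω => ?_)
  exact abs_prod_le_sum fun i => Y i ω

lemma approx4 {Ω : Type*} [MeasurableSpace Ω] (ν : Measure Ω) [IsProbabilityMeasure ν]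
    (Y W : Fin 4 → Ω → ℝ) (hY : ∀ i, Measurable (Y i)) (hW : ∀ i, Measurable (W i))
    (hY4 : ∀ i, Integrable (fun ω => Y i ω ^ 4) ν) (N τ a : ℝ) (hN : 0 ≤ N)
    (hτ : ∀ i, ∫ ω, tailR N (Y i ω) ∂ν ≤ τ) (hI : ∀ i, Integrable (fun ω => |Y i ω - W i ω|) ν)
    (ha : ∀ i, ∫ ω, |Y i ω - W i ω| ∂ν ≤ a) :
    |∫ ω, ∏ i, Y i ω ∂ν - ∫ ω, ∏ i, clipR N (W i ω) ∂ν| ≤ 8 * τ + 4 * N ^ 3 * a := by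
  have hT : ∀ i, Integrable (fun ω => tailR N (Y i ω)) ν := fun i =>
    (hY4 i).mono' ((measurable_tailR N).comp (hY i)).aestronglyMeasurable
      (ae_of_all _ fun ω => by
        rw [Real.norm_eq_abs, abs_of_nonneg (tailR_nonneg _ _)]; exact tailR_le _ _)
  have hP := integrable_prod4 ν Y hY hY4
  have hQ : Integrable (fun ω => ∏ i, clipR N (W i ω)) ν :=
    (integrable_const (N ^ 4)).mono'
      (Finset.measurable_prod _ fun i _ => (measurable_clipR N).comp (hW i)).aestronglyMeasurable
      (ae_of_all _ fun ω => abs_prod_le_of_max _ _ fun i => abs_clipR_le hN _)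
  have hS : ∀ i, Integrable (fun ω => 2 * tailR N (Y i ω) + N ^ 3 * |Y i ω - W i ω|) ν :=
    fun i => ((hT i).const_mul _).add ((hI i).const_mul _)
  rw [← integral_sub hP hQ]
  calc _ ≤ ∫ ω, |∏ i, Y i ω - ∏ i, clipR N (W i ω)| ∂ν := abs_integral_le_integral_abs
    _ ≤ ∫ ω, ∑ i, (2 * tailR N (Y i ω) + N ^ 3 * |Y i ω - W i ω|) ∂ν :=
        integral_mono (hP.sub hQ).abs
          (integrable_finsetSum _ fun i _ => hS i)
          fun ω => pointwise4 hN _ _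
    _ = ∑ i, (2 * ∫ ω, tailR N (Y i ω) ∂ν + N ^ 3 * ∫ ω, |Y i ω - W i ω| ∂ν) := by
        rw [integral_finsetSum _ fun i _ => hS i]
        refine Finset.sum_congr rfl fun i _ => ?_
        rw [integral_add ((hT i).const_mul _) ((hI i).const_mul _), integral_const_mul,
          integral_const_mul]
    _ ≤ ∑ _i : Fin 4, (2 * τ + N ^ 3 * a) := by
        refine Finset.sum_le_sum fun i _ => ?_
        have := mul_le_mul_of_nonneg_left (ha i) (pow_nonneg hN 3)
        linarith [hτ i]
    _ = 8 * τ + 4 * N ^ 3 * a := by simp; ring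

lemma abs_prod_clip_le {N : ℝ} (hN : 0 ≤ N) (s : Finset (Fin 4)) (w : Fin 4 → ℝ) :
    |∏ i ∈ s, clipR N (w i)| ≤ N ^ s.card := by
  rw [Finset.abs_prod]
  calc ∏ i ∈ s, |clipR N (w i)| ≤ ∏ _i ∈ s, N :=
        Finset.prod_le_prod (fun i _ => abs_nonneg _) fun i _ => abs_clipR_le hN _
    _ = N ^ s.card := by simp

lemma integral_prod_split {Ω : Type*} [MeasurableSpace Ω] (μ : Measure Ω) [IsProbabilityMeasure μ]
    (s : Finset (Fin 4)) (Y : Fin 4 → Ω → ℝ) :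
    ∫ p : Ω × Ω, ∏ i, Y i (if i ∈ s then p.1 else p.2) ∂(μ.prod μ)
      = (∫ ω, ∏ i ∈ s, Y i ω ∂μ) * (∫ ω, ∏ i ∈ sᶜ, Y i ω ∂μ) := by
  rw [← integral_prod_mul]
  congr 1
  ext p
  rw [← Finset.prod_mul_prod_compl s]
  congr 1
  · exact Finset.prod_congr rfl fun i hi => by rw [if_pos hi]
  · exact Finset.prod_congr rfl fun i hi => by rw [if_neg (Finset.mem_compl.1 hi)]

lemma split4 {Ω : Type*} (m₁ m₂ : MeasurableSpace Ω) [mΩ : MeasurableSpace Ω] (μ : Measure Ω)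
    [IsProbabilityMeasure μ] (h₁ : m₁ ≤ mΩ) (h₂ : m₂ ≤ mΩ) (s : Finset (Fin 4))
    (Y W : Fin 4 → Ω → ℝ) (hY : ∀ i, Measurable (Y i)) (hW : ∀ i, Measurable (W i))
    (hW1 : ∀ i ∈ s, Measurable[m₁] (W i)) (hW2 : ∀ i ∉ s, Measurable[m₂] (W i))
    (hY4 : ∀ i, Integrable (fun ω => Y i ω ^ 4) μ) (N τ a : ℝ) (hN : 0 ≤ N)
    (hτ : ∀ i, ∫ ω, tailR N (Y i ω) ∂μ ≤ τ) (hI : ∀ i, Integrable (fun ω => |Y i ω - W i ω|) μ)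
    (ha : ∀ i, ∫ ω, |Y i ω - W i ω| ∂μ ≤ a) :
    |∫ ω, ∏ i, Y i ω ∂μ - (∫ ω, ∏ i ∈ s, Y i ω ∂μ) * (∫ ω, ∏ i ∈ sᶜ, Y i ω ∂μ)|
      ≤ 16 * τ + 8 * N ^ 3 * a + N ^ 4 * betaCoeff μ m₁ m₂ := by
  have A1 := approx4 μ Y W hY hW hY4 N τ a hN hτ hI ha
  have mp : ∀ i : Fin 4, MeasurePreserving (fun p : Ω × Ω => if i ∈ s then p.1 else p.2)
      (μ.prod μ) μ := by
    intro i
    by_cases hi : i ∈ s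
    · simp only [hi, if_true]; exact measurePreserving_fst
    · simp only [hi, if_false]; exact measurePreserving_snd
  have tr : ∀ i : Fin 4, ∀ F : Ω → ℝ, Measurable F →
      ∫ p : Ω × Ω, F (if i ∈ s then p.1 else p.2) ∂(μ.prod μ) = ∫ ω, F ω ∂μ := by
    intro i F hF
    rw [← (mp i).map_eq, integral_map (mp i).measurable.aemeasurable hF.aestronglyMeasurable,
      (mp i).map_eq]
  have A2 := approx4 (μ.prod μ) (fun i p => Y i (if i ∈ s then p.1 else p.2))
    (fun i p => W i (if i ∈ s then p.1 else p.2)) (fun i => (hY i).comp (mp i).measurable)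
    (fun i => (hW i).comp (mp i).measurable)
    (fun i => (mp i).integrable_comp_of_integrable (hY4 i)) N τ a hN
    (fun i => by
      rw [tr i (fun ω => tailR N (Y i ω)) ((measurable_tailR N).comp (hY i))]; exact hτ i)
    (fun i => (mp i).integrable_comp_of_integrable (hI i))
    (fun i => by
      rw [tr i (fun ω => |Y i ω - W i ω|) (((hY i).sub (hW i)).abs)]; exact ha i)
  rw [integral_prod_split μ s Y, integral_prod_split μ s (fun i ω => clipR N (W i ω))] at A2
  have A3 := cov_le m₁ m₂ μ h₁ h₂ (fun ω => ∏ i ∈ s, clipR N (W i ω))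
    (fun ω => ∏ i ∈ sᶜ, clipR N (W i ω))
    (Finset.measurable_prod _ fun i hi => (measurable_clipR N).comp (hW1 i hi))
    (Finset.measurable_prod _ fun i hi =>
      (measurable_clipR N).comp (hW2 i (Finset.mem_compl.1 hi)))
    (N ^ s.card) (N ^ sᶜ.card) (by positivity) (by positivity)
    (fun ω => abs_prod_clip_le hN s fun i => W i ω) (fun ω => abs_prod_clip_le hN sᶜ fun i => W i ω)
  rw [← pow_add, Finset.card_add_card_compl, Fintype.card_fin] at A3
  simp_rw [Finset.prod_mul_prod_compl] at A3
  rw [abs_le] at *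
  constructor <;> linarith [A1.1, A1.2, A2.1, A2.2, A3.1, A3.2]

end ClipPart

section StatPart

lemma measurable_shiftZ {Ω : Type*} [MeasurableSpace Ω] (Z : ℤ → Ω → ℝ)
    (hZ : ∀ t, Measurable (Z t)) (t : ℤ) : Measurable (fun ω => fun s : ℤ => Z (s + t) ω) :=
  measurable_pi_lambda _ fun s => hZ (s + t)

lemma stat_integral {Ω : Type*} [MeasurableSpace Ω] (μ : Measure Ω) (Z : ℤ → Ω → ℝ)
    (hZ : ∀ t, Measurable (Z t)) (hstat : Stationary μ Z) (F : (ℤ → ℝ) → ℝ) (hF : Measurable F)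
    (t : ℤ) : ∫ ω, F (fun s => Z (s + t) ω) ∂μ = ∫ ω, F (fun s => Z s ω) ∂μ := by
  have h0 : Measurable (fun ω => fun s : ℤ => Z s ω) := measurable_pi_lambda _ hZ
  have h := hstat t
  have h1 := integral_map (μ := μ) (measurable_shiftZ Z hZ t).aemeasurable
    hF.aestronglyMeasurable
  have h2 := integral_map (μ := μ) h0.aemeasurable hF.aestronglyMeasurable
  rw [← h1, ← h2, h]

lemma stat_integrable {Ω : Type*} [MeasurableSpace Ω] (μ : Measure Ω) (Z : ℤ → Ω → ℝ)
    (hZ : ∀ t, Measurable (Z t)) (hstat : Stationary μ Z) (F : (ℤ → ℝ) → ℝ) (hF : Measurable F)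
    (t : ℤ) (hi : Integrable (fun ω => F (fun s => Z s ω)) μ) :
    Integrable (fun ω => F (fun s => Z (s + t) ω)) μ := by
  have h0 : Measurable (fun ω => fun s : ℤ => Z s ω) := measurable_pi_lambda _ hZ
  have h1 := integrable_map_measure (μ := μ) (g := F) hF.aestronglyMeasurable
    (measurable_shiftZ Z hZ t).aemeasurable
  have h2 := integrable_map_measure (μ := μ) (g := F) hF.aestronglyMeasurable h0.aemeasurable
  rw [hstat t] at h1
  exact h1.1 (h2.2 hi)

lemma exists_factor {Ω : Type*} [mΩ : MeasurableSpace Ω] (Z : ℤ → Ω → ℝ) (k l : ℤ)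
    (w : Ω → ℝ) (hw : Measurable[sigmaIcc Z k l] w) :
    ∃ g : (ℤ → ℝ) → ℝ, Measurable g ∧ (∀ ω, w ω = g (fun s => Z s ω)) ∧
      ∀ t : ℤ, Measurable[sigmaIcc Z (k + t) (l + t)] (fun ω => g (fun s => Z (s + t) ω)) := by
  let ζ : Ω → (Set.Icc k l → ℝ) := fun ω i => Z i.1 ω
  have e : sigmaIcc Z k l = MeasurableSpace.comap ζ MeasurableSpace.pi := by
    unfold sigmaIcc MeasurableSpace.pi
    rw [MeasurableSpace.comap_iSup, iSup_subtype']
    refine iSup_congr fun i => ?_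
    rw [MeasurableSpace.comap_comp]
    rfl
  rw [e] at hw
  obtain ⟨h, hm, hh⟩ := hw.exists_eq_measurable_comp
  refine ⟨fun z => h (fun i => z i.1), hm.comp (by fun_prop), fun ω => congrFun hh ω, fun t => ?_⟩
  refine hm.comp (@measurable_pi_lambda _ _ _ (sigmaIcc Z (k + t) (l + t)) _ _ fun i => ?_)
  have : MeasurableSpace.comap (Z (i.1 + t)) inferInstance ≤ sigmaIcc Z (k + t) (l + t) :=
    le_iSup₂_of_le (i.1 + t) ⟨by have := i.2.1; omega, by have := i.2.2; omega⟩ le_rfl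
  exact (comap_measurable _).mono this le_rfl

lemma sigmaIcc_mono {Ω : Type*} [MeasurableSpace Ω] (Z : ℤ → Ω → ℝ) {k l k' l' : ℤ}
    (h : k' ≤ k) (h' : l ≤ l') : sigmaIcc Z k l ≤ sigmaIcc Z k' l' :=
  biSup_mono fun _ hi => ⟨h.trans hi.1, hi.2.trans h'⟩

lemma sigmaIcc_le_Ici {Ω : Type*} [MeasurableSpace Ω] (Z : ℤ → Ω → ℝ) {k l k' : ℤ}
    (h : k' ≤ k) : sigmaIcc Z k l ≤ sigmaIci Z k' :=
  biSup_mono fun _ hi => h.trans hi.1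

/-- The four factors: either an observation or the constant one. -/
def fac {Ω : Type*} (X : ℤ → Ω → ℝ) (e : Fin 4 → Bool) (t : Fin 4 → ℤ) (i : Fin 4) (ω : Ω) : ℝ :=
  if e i then X (t i) ω else 1

lemma X_split_aux {Ω : Type*} [mΩ : MeasurableSpace Ω] (μ : Measure Ω) [IsProbabilityMeasure μ]
    (Z : ℤ → Ω → ℝ) (hZ : ∀ t, Measurable (Z t)) (hstat : Stationary μ Z)
    (f : (ℤ → ℝ) → ℝ) (hf : Measurable f)
    (X : ℤ → Ω → ℝ) (hX : ∀ t ω, X t ω = f (fun k => Z (k + t) ω))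
    (m : ℕ) (a : ℝ) (ha0 : 0 ≤ a) (happrox : ∫ ω, |X 0 ω - (μ[X 0 | sigmaIcc Z (-(m : ℤ)) (m : ℤ)]) ω| ∂μ ≤ a)
    (hXint : Integrable (X 0) μ) (hX4 : Integrable (fun ω => X 0 ω ^ 4) μ) (N : ℝ) (hN : 1 ≤ N)
    (e : Fin 4 → Bool) (t : Fin 4 → ℤ) (s : Finset (Fin 4)) (n : ℕ) (hn : 1 ≤ n)
    (hs : ∀ i ∈ s, (m : ℤ) + 1 ≤ t i ∧ t i + m ≤ n) (hs' : ∀ i ∉ s, (n : ℤ) + m + m ≤ t i) :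
    |∫ ω, ∏ i, fac X e t i ω ∂μ
      - (∫ ω, ∏ i ∈ s, fac X e t i ω ∂μ) * (∫ ω, ∏ i ∈ sᶜ, fac X e t i ω ∂μ)|
      ≤ 16 * ∫ ω, tailR N (X 0 ω) ∂μ + 8 * N ^ 3 * a + N ^ 4 * betaMix μ Z m := by
  have hX0 : ∀ ω, X 0 ω = f (fun k => Z k ω) := fun ω => by rw [hX]; simp
  obtain ⟨g, hg, hg0, hgm⟩ := exists_factor Z (-(m : ℤ)) m
    (μ[X 0 | sigmaIcc Z (-(m : ℤ)) (m : ℤ)]) stronglyMeasurable_condExp.measurable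
  have hXm : ∀ u, Measurable (X u) := fun u => by
    have : X u = fun ω => f (fun k => Z (k + u) ω) := funext (hX u)
    rw [this]
    exact hf.comp (measurable_shiftZ Z hZ u)
  have hgM : ∀ u, Measurable (fun ω => g (fun s => Z (s + u) ω)) := fun u =>
    hg.comp (measurable_shiftZ Z hZ u)
  have hi4 : ∀ u, Integrable (fun ω => X u ω ^ 4) μ := fun u => by
    simp_rw [hX u]
    simp_rw [hX0] at hX4
    exact stat_integrable μ Z hZ hstat (fun z => f z ^ 4) (by fun_prop) u hX4
  have hτu : ∀ u, ∫ ω, tailR N (X u ω) ∂μ = ∫ ω, tailR N (X 0 ω) ∂μ := fun u => by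
    simp_rw [hX u, hX0]
    exact stat_integral μ Z hZ hstat (fun z => tailR N (f z)) ((measurable_tailR N).comp hf) u
  have hIu : ∀ u, Integrable (fun ω => |X u ω - g (fun s => Z (s + u) ω)|) μ := fun u => by
    have h0 : Integrable (fun ω => |X 0 ω - (μ[X 0 | sigmaIcc Z (-(m : ℤ)) (m : ℤ)]) ω|) μ :=
      (hXint.sub integrable_condExp).abs
    simp_rw [hX u]
    simp_rw [hg0, hX0] at h0
    exact stat_integrable μ Z hZ hstat (fun z => |f z - g z|) (by fun_prop) u h0
  have hau : ∀ u, ∫ ω, |X u ω - g (fun s => Z (s + u) ω)| ∂μ ≤ a := fun u => by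
    refine le_trans (le_of_eq ?_) happrox
    simp_rw [hX u, hg0, hX0]
    exact stat_integral μ Z hZ hstat (fun z => |f z - g z|) (by fun_prop) u
  have hτ0 : 0 ≤ ∫ ω, tailR N (X 0 ω) ∂μ := integral_nonneg fun ω => tailR_nonneg _ _
  have hn' : ((n : ℕ) : ℤ) = n := rfl
  have main := split4 (sigmaIcc Z 1 n) (sigmaIci Z (n + m)) μ (sigmaIcc_le Z hZ _ _)
    (sigmaIci_le Z hZ _) s (fac X e t)
    (fun i ω => if e i then g (fun k => Z (k + t i) ω) else 1) ?_ ?_ ?_ ?_ ?_ N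
    (∫ ω, tailR N (X 0 ω) ∂μ) a (by linarith) ?_ ?_ ?_
  · refine main.trans ?_
    have := betaCoeff_le_betaMix μ Z hZ m n hn
    gcongr
  · intro i
    unfold fac
    cases e i
    · simp
    · simpa using hXm (t i)
  · intro i
    cases e i
    · simp
    · simpa using hgM (t i)
  · intro i hi
    cases e i
    · simp
    · simp only [if_true]
      exact (hgm (t i)).mono (sigmaIcc_mono Z (by have := hs i hi; omega)
        (by have := hs i hi; omega)) le_rfl
  · intro i hi
    cases e i
    · simp
    · simp only [if_true]
      exact (hgm (t i)).mono (sigmaIcc_le_Ici Z (by have := hs' i hi; omega)) le_rfl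
  · intro i
    unfold fac
    cases e i
    · simp
    · simpa using hi4 (t i)
  · intro i
    unfold fac
    cases e i
    · simpa [tailR, not_lt.2 hN] using hτ0
    · simpa using (hτu (t i)).le
  · intro i
    unfold fac
    cases e i
    · simp
    · simpa using hIu (t i)
  · intro i
    unfold fac
    cases e i
    · simpa using ha0
    · simpa using hau (t i)

lemma fac_shift {Ω : Type*} [mΩ : MeasurableSpace Ω] (μ : Measure Ω)
    (Z : ℤ → Ω → ℝ) (hZ : ∀ t, Measurable (Z t)) (hstat : Stationary μ Z)
    (f : (ℤ → ℝ) → ℝ) (hf : Measurable f)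
    (X : ℤ → Ω → ℝ) (hX : ∀ t ω, X t ω = f (fun k => Z (k + t) ω))
    (e : Fin 4 → Bool) (t : Fin 4 → ℤ) (s : Finset (Fin 4)) (h : ℤ) :
    ∫ ω, ∏ i ∈ s, fac X e (fun i => t i + h) i ω ∂μ = ∫ ω, ∏ i ∈ s, fac X e t i ω ∂μ := by
  have hF : Measurable (fun z : ℤ → ℝ => ∏ i ∈ s,
      (if e i then f (fun k => z (k + t i)) else 1)) := by
    refine Finset.measurable_prod _ fun i _ => ?_
    cases e i
    · simp
    · simp only [if_true]; exact hf.comp (by fun_prop)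
  have := stat_integral μ Z hZ hstat _ hF h
  unfold fac
  simp_rw [hX]
  simpa [add_assoc] using this

lemma X_split {Ω : Type*} [mΩ : MeasurableSpace Ω] (μ : Measure Ω) [IsProbabilityMeasure μ]
    (Z : ℤ → Ω → ℝ) (hZ : ∀ t, Measurable (Z t)) (hstat : Stationary μ Z)
    (f : (ℤ → ℝ) → ℝ) (hf : Measurable f)
    (X : ℤ → Ω → ℝ) (hX : ∀ t ω, X t ω = f (fun k => Z (k + t) ω))
    (m : ℕ) (a : ℝ) (ha0 : 0 ≤ a) (happrox : ∫ ω, |X 0 ω - (μ[X 0 | sigmaIcc Z (-(m : ℤ)) (m : ℤ)]) ω| ∂μ ≤ a)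
    (hXint : Integrable (X 0) μ) (hX4 : Integrable (fun ω => X 0 ω ^ 4) μ) (N : ℝ) (hN : 1 ≤ N)
    (e : Fin 4 → Bool) (t : Fin 4 → ℤ) (s : Finset (Fin 4)) (L T : ℤ) (hLT : L ≤ T)
    (hs : ∀ i ∈ s, L ≤ t i ∧ t i ≤ T) (hs' : ∀ i ∉ s, T + 3 * m ≤ t i) :
    |∫ ω, ∏ i, fac X e t i ω ∂μ
      - (∫ ω, ∏ i ∈ s, fac X e t i ω ∂μ) * (∫ ω, ∏ i ∈ sᶜ, fac X e t i ω ∂μ)|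
      ≤ 16 * ∫ ω, tailR N (X 0 ω) ∂μ + 8 * N ^ 3 * a + N ^ 4 * betaMix μ Z m := by
  obtain ⟨n, hn⟩ : ∃ n : ℕ, (n : ℤ) = T - L + 2 * m + 1 :=
    ⟨(T - L + 2 * m + 1).toNat, Int.toNat_of_nonneg (by omega)⟩
  have := X_split_aux μ Z hZ hstat f hf X hX m a ha0 happrox hXint hX4 N hN e
    (fun i => t i + (m + 1 - L)) s n (by omega)
    (fun i hi => by have := hs i hi; constructor <;> omega)
    (fun i hi => by have := hs' i hi; omega)
  rw [fac_shift μ Z hZ hstat f hf X hX, fac_shift μ Z hZ hstat f hf X hX,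
    fac_shift μ Z hZ hstat f hf X hX] at this
  exact this

end StatPart

section CombPart

/-- Indicator of `j ≤ i`. -/
def uInd (i j : ℕ) : ℝ := if j ≤ i then 1 else 0

lemma uInd_nonneg (i j : ℕ) : 0 ≤ uInd i j := by unfold uInd; split_ifs <;> norm_num

lemma sum_uInd_le (n i : ℕ) : ∑ j ∈ Finset.range n, uInd i j ≤ (i : ℝ) + 1 := by
  unfold uInd
  rw [← Finset.sum_filter, Finset.sum_const, nsmul_eq_mul, mul_one]
  have : (Finset.filter (fun j => j ≤ i) (Finset.range n)).card ≤ (Finset.range (i + 1)).card := by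
    refine Finset.card_le_card fun j hj => ?_
    rw [Finset.mem_filter] at hj
    exact Finset.mem_range.2 (by omega)
  rw [Finset.card_range] at this
  exact_mod_cast this

/-- The bounding kernel. -/
def kerG (r : ℕ → ℝ) (i j k : ℕ) : ℝ :=
  r i * (uInd i j * uInd i k) + r j * (uInd j i * uInd j k) + r k * (uInd k i * uInd k j)
    + r i * r k

lemma kerG_nonneg (r : ℕ → ℝ) (hr : ∀ g, 0 ≤ r g) (i j k : ℕ) : 0 ≤ kerG r i j k := by
  have := uInd_nonneg
  have h1 := mul_nonneg (hr i) (mul_nonneg (this i j) (this i k))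
  have h2 := mul_nonneg (hr j) (mul_nonneg (this j i) (this j k))
  have h3 := mul_nonneg (hr k) (mul_nonneg (this k i) (this k j))
  have h4 := mul_nonneg (hr i) (hr k)
  unfold kerG; linarith

lemma sum_ker_one (r : ℕ → ℝ) (hr : ∀ g, 0 ≤ r g)
    (hsum : Summable fun g : ℕ => ((g : ℝ) + 1) ^ 2 * r g) (n : ℕ) :
    ∑ i ∈ Finset.range n, ∑ j ∈ Finset.range n, ∑ k ∈ Finset.range n,
      r i * (uInd i j * uInd i k) ≤ ∑' g : ℕ, ((g : ℝ) + 1) ^ 2 * r g := by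
  calc _ ≤ ∑ i ∈ Finset.range n, ((i : ℝ) + 1) ^ 2 * r i := by
        refine Finset.sum_le_sum fun i _ => ?_
        simp_rw [← Finset.mul_sum]
        rw [← Finset.sum_mul, mul_comm, sq]
        have h := sum_uInd_le n i
        have h0 : 0 ≤ ∑ j ∈ Finset.range n, uInd i j := Finset.sum_nonneg fun j _ => uInd_nonneg i j
        have := hr i
        gcongr
    _ ≤ _ := hsum.sum_le_tsum _ fun g _ => mul_nonneg (by positivity) (hr g)

lemma sum_kerG (r : ℕ → ℝ) (hr : ∀ g, 0 ≤ r g)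
    (hsum : Summable fun g : ℕ => ((g : ℝ) + 1) ^ 2 * r g) (n : ℕ) :
    ∑ i ∈ Finset.range n, ∑ j ∈ Finset.range n, ∑ k ∈ Finset.range n, kerG r i j k
      ≤ 3 * (∑' g : ℕ, ((g : ℝ) + 1) ^ 2 * r g)
        + n * (∑' g : ℕ, ((g : ℝ) + 1) ^ 2 * r g) ^ 2 := by
  have h1 := sum_ker_one r hr hsum n
  have h2 : ∑ i ∈ Finset.range n, ∑ j ∈ Finset.range n, ∑ k ∈ Finset.range n,
      r j * (uInd j i * uInd j k) ≤ ∑' g : ℕ, ((g : ℝ) + 1) ^ 2 * r g := by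
    rw [Finset.sum_comm]; exact h1
  have h3 : ∑ i ∈ Finset.range n, ∑ j ∈ Finset.range n, ∑ k ∈ Finset.range n,
      r k * (uInd k i * uInd k j) ≤ ∑' g : ℕ, ((g : ℝ) + 1) ^ 2 * r g := by
    rw [Finset.sum_congr rfl fun i _ => Finset.sum_comm, Finset.sum_comm]; exact h1
  have h4 : ∑ i ∈ Finset.range n, ∑ j ∈ Finset.range n, ∑ k ∈ Finset.range n,
      r i * r k ≤ n * (∑' g : ℕ, ((g : ℝ) + 1) ^ 2 * r g) ^ 2 := by
    have e : ∑ i ∈ Finset.range n, ∑ _j ∈ Finset.range n, ∑ k ∈ Finset.range n, r i * r k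
        = n * (∑ i ∈ Finset.range n, r i) ^ 2 := by
      simp_rw [← Finset.mul_sum, Finset.sum_const, Finset.card_range, nsmul_eq_mul]
      rw [← Finset.sum_mul]; ring
    rw [e]
    have h5 : ∑ i ∈ Finset.range n, r i ≤ ∑' g : ℕ, ((g : ℝ) + 1) ^ 2 * r g := by
      refine le_trans (Finset.sum_le_sum fun i _ => ?_)
        (hsum.sum_le_tsum (Finset.range n) fun g _ => mul_nonneg (by positivity) (hr g))
      have : (1 : ℝ) ≤ ((i : ℝ) + 1) ^ 2 := one_le_pow₀ (by linarith [Nat.cast_nonneg (α := ℝ) i])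
      nlinarith [hr i]
    have h0 : 0 ≤ ∑ i ∈ Finset.range n, r i := Finset.sum_nonneg fun i _ => hr i
    gcongr
  unfold kerG
  simp_rw [Finset.sum_add_distrib]
  linarith

lemma sum_mono_le (F : (Fin 4 → ℕ) → ℝ) (r : ℕ → ℝ) (hr : ∀ g, 0 ≤ r g)
    (hsum : Summable fun g : ℕ => ((g : ℝ) + 1) ^ 2 * r g)
    (hF : ∀ t : Fin 4 → ℕ, Monotone t → F t ≤ kerG r (t 1 - t 0) (t 2 - t 1) (t 3 - t 2)) (n : ℕ)
    (S : Finset (Fin 4 → ℕ)) (hS : ∀ t ∈ S, Monotone t ∧ ∀ i, 1 ≤ t i ∧ t i ≤ n) :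
    ∑ t ∈ S, F t ≤ (3 * (∑' g : ℕ, ((g : ℝ) + 1) ^ 2 * r g)
        + (∑' g : ℕ, ((g : ℝ) + 1) ^ 2 * r g) ^ 2) * (n : ℝ) ^ 2 := by
  classical
  set R := ∑' g : ℕ, ((g : ℝ) + 1) ^ 2 * r g with hR
  have hR0 : 0 ≤ R := tsum_nonneg fun g => mul_nonneg (by positivity) (hr g)
  let φ : (Fin 4 → ℕ) → ℕ × ℕ × ℕ × ℕ := fun t => (t 0, t 1 - t 0, t 2 - t 1, t 3 - t 2)
  have hinj : Set.InjOn φ S := by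
    intro t ht u hu h
    have h1 := (hS t ht).1
    have h2 := (hS u hu).1
    have a1 := h1 (show (0 : Fin 4) ≤ 1 by decide)
    have a2 := h1 (show (1 : Fin 4) ≤ 2 by decide)
    have a3 := h1 (show (2 : Fin 4) ≤ 3 by decide)
    have b1 := h2 (show (0 : Fin 4) ≤ 1 by decide)
    have b2 := h2 (show (1 : Fin 4) ≤ 2 by decide)
    have b3 := h2 (show (2 : Fin 4) ≤ 3 by decide)
    simp only [φ, Prod.mk.injEq] at h
    obtain ⟨c0, c1, c2, c3⟩ := h
    ext i
    fin_cases i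
    · exact c0
    · change t 1 = u 1; omega
    · change t 2 = u 2; omega
    · change t 3 = u 3; omega
  calc ∑ t ∈ S, F t ≤ ∑ t ∈ S, (fun p : ℕ × ℕ × ℕ × ℕ => kerG r p.2.1 p.2.2.1 p.2.2.2) (φ t) :=
        Finset.sum_le_sum fun t ht => hF t (hS t ht).1
    _ = ∑ p ∈ S.image φ, kerG r p.2.1 p.2.2.1 p.2.2.2 := by
        rw [Finset.sum_image hinj]
    _ ≤ ∑ p ∈ Finset.Icc 1 n ×ˢ Finset.range n ×ˢ Finset.range n ×ˢ Finset.range n,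
          kerG r p.2.1 p.2.2.1 p.2.2.2 := by
        refine Finset.sum_le_sum_of_subset_of_nonneg ?_ fun p _ _ => kerG_nonneg r hr _ _ _
        intro p hp
        obtain ⟨t, ht, rfl⟩ := Finset.mem_image.1 hp
        have h := (hS t ht).2
        have h0 := h 0
        have h1 := h 1
        have h2 := h 2
        have h3 := h 3
        simp only [φ, Finset.mem_product, Finset.mem_Icc, Finset.mem_range]
        refine ⟨h0, ?_, ?_, ?_⟩ <;> omega
    _ = n * ∑ i ∈ Finset.range n, ∑ j ∈ Finset.range n, ∑ k ∈ Finset.range n, kerG r i j k := by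
        rw [Finset.sum_product]
        simp only [Finset.sum_const, Nat.card_Icc, Finset.sum_product]
        simp
    _ ≤ n * (3 * R + n * R ^ 2) := by
        have := sum_kerG r hr hsum n
        gcongr
    _ ≤ _ := by
        have : (n : ℝ) ≤ (n : ℝ) ^ 2 := by exact_mod_cast Nat.le_self_pow (by norm_num) n
        nlinarith

lemma sum_all_le (F : (Fin 4 → ℕ) → ℝ) (hF0 : ∀ t, 0 ≤ F t)
    (hsymm : ∀ (t : Fin 4 → ℕ) (σ : Equiv.Perm (Fin 4)), F (t ∘ σ) = F t)
    (r : ℕ → ℝ) (hr : ∀ g, 0 ≤ r g)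
    (hsum : Summable fun g : ℕ => ((g : ℝ) + 1) ^ 2 * r g)
    (hF : ∀ t : Fin 4 → ℕ, Monotone t → F t ≤ kerG r (t 1 - t 0) (t 2 - t 1) (t 3 - t 2)) (n : ℕ) :
    ∑ t ∈ Fintype.piFinset (fun _ : Fin 4 => Finset.Icc 1 n), F t
      ≤ 24 * ((3 * (∑' g : ℕ, ((g : ℝ) + 1) ^ 2 * r g)
        + (∑' g : ℕ, ((g : ℝ) + 1) ^ 2 * r g) ^ 2) * (n : ℝ) ^ 2) := by
  classical
  set P := Fintype.piFinset (fun _ : Fin 4 => Finset.Icc 1 n) with hP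
  have hmono := sum_mono_le F r hr hsum hF n (P.filter Monotone) (fun t ht => by
    rw [Finset.mem_filter, hP, Fintype.mem_piFinset] at ht
    exact ⟨ht.2, fun i => Finset.mem_Icc.1 (ht.1 i)⟩)
  have hre : ∀ σ : Equiv.Perm (Fin 4),
      ∑ t ∈ P, (if Monotone (t ∘ σ) then F t else 0) = ∑ t ∈ P.filter Monotone, F t := by
    intro σ
    rw [Finset.sum_filter]
    refine Finset.sum_bij' (fun t _ => t ∘ σ) (fun t _ => t ∘ σ.symm) ?_ ?_ ?_ ?_ ?_
    · intro t ht
      rw [hP, Fintype.mem_piFinset] at ht ⊢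
      exact fun i => ht _
    · intro t ht
      rw [hP, Fintype.mem_piFinset] at ht ⊢
      exact fun i => ht _
    · intro t ht; ext i; simp
    · intro t ht; ext i; simp
    · intro t ht
      rw [hsymm]
  calc ∑ t ∈ P, F t ≤ ∑ t ∈ P, ∑ σ : Equiv.Perm (Fin 4), (if Monotone (t ∘ σ) then F t else 0) := by
        refine Finset.sum_le_sum fun t _ => ?_
        have := Finset.single_le_sum
          (f := fun σ : Equiv.Perm (Fin 4) => if Monotone (t ∘ σ) then F t else 0)
          (fun σ _ => by
            show 0 ≤ if Monotone (t ∘ σ) then F t else 0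
            split_ifs
            · exact hF0 t
            · exact le_rfl) (Finset.mem_univ (Tuple.sort t))
        simpa [Tuple.monotone_sort t] using this
    _ = ∑ _σ : Equiv.Perm (Fin 4), ∑ t ∈ P.filter Monotone, F t := by
        rw [Finset.sum_comm]
        exact Finset.sum_congr rfl fun σ _ => hre σ
    _ = 24 * ∑ t ∈ P.filter Monotone, F t := by
        rw [Finset.sum_const, Finset.card_univ, Fintype.card_perm, Fintype.card_fin, nsmul_eq_mul]
        norm_num [Nat.factorial]
    _ ≤ _ := by linarith

lemma summable_div_three (h : ℕ → ℝ) (hh : ∀ m, 0 ≤ h m) (hs : Summable h) :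
    Summable (fun g : ℕ => h (g / 3)) := by
  have e : ∀ n, ∑ g ∈ Finset.range (3 * n), h (g / 3) = 3 * ∑ m ∈ Finset.range n, h m := by
    intro n
    induction n with
    | zero => simp
    | succ n ih =>
      rw [show 3 * (n + 1) = 3 * n + 1 + 1 + 1 by ring, Finset.sum_range_succ,
        Finset.sum_range_succ, Finset.sum_range_succ, ih, Finset.sum_range_succ,
        show (3 * n) / 3 = n by omega, show (3 * n + 1) / 3 = n by omega,
        show (3 * n + 1 + 1) / 3 = n by omega]
      ring
  refine summable_of_sum_range_le (c := 3 * ∑' m, h m) (fun g => hh _) fun n => ?_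
  calc ∑ g ∈ Finset.range n, h (g / 3) ≤ ∑ g ∈ Finset.range (3 * n), h (g / 3) :=
        Finset.sum_le_sum_of_subset_of_nonneg (Finset.range_mono (by omega)) fun g _ _ => hh _
    _ = 3 * ∑ m ∈ Finset.range n, h m := e n
    _ ≤ _ := by
        have := hs.sum_le_tsum (Finset.range n) fun m _ => hh m
        linarith

lemma summable_r (ρ : ℕ → ℝ) (hρ : ∀ m, 0 ≤ ρ m) (hs : Summable fun m : ℕ => (m : ℝ) ^ 2 * ρ m) :
    Summable (fun g : ℕ => ((g : ℝ) + 1) ^ 2 * ρ (g / 3)) := by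
  have h1 : Summable (fun m : ℕ => ((m : ℝ) + 1) ^ 2 * ρ m) := by
    rw [← summable_nat_add_iff 1] at hs ⊢
    refine (hs.mul_left 4).of_nonneg_of_le (fun m => mul_nonneg (by positivity) (hρ _)) fun m => ?_
    rw [← mul_assoc]
    refine mul_le_mul_of_nonneg_right ?_ (hρ _)
    push_cast
    nlinarith [Nat.cast_nonneg (α := ℝ) m]
  have h2 := summable_div_three (fun m : ℕ => ((m : ℝ) + 1) ^ 2 * ρ m)
    (fun m => mul_nonneg (by positivity) (hρ _)) h1
  refine (h2.mul_left 9).of_nonneg_of_le (fun m => mul_nonneg (by positivity) (hρ _)) fun g => ?_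
  rw [← mul_assoc]
  refine mul_le_mul_of_nonneg_right ?_ (hρ _)
  have : (g : ℝ) + 1 ≤ 3 * (((g / 3 : ℕ) : ℝ) + 1) := by
    have : g + 1 ≤ 3 * (g / 3 + 1) := by omega
    exact_mod_cast this
  calc ((g : ℝ) + 1) ^ 2 ≤ (3 * (((g / 3 : ℕ) : ℝ) + 1)) ^ 2 := by gcongr
    _ = _ := by ring

end CombPart

section MainPart

lemma core_bound {Ω : Type*} [mΩ : MeasurableSpace Ω] (μ : Measure Ω) [IsProbabilityMeasure μ]
    (Z : ℤ → Ω → ℝ) (hZ : ∀ t, Measurable (Z t)) (hstat : Stationary μ Z)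
    (f : (ℤ → ℝ) → ℝ) (hf : Measurable f)
    (X : ℤ → Ω → ℝ) (hX : ∀ t ω, X t ω = f (fun k => Z (k + t) ω))
    (a : ℕ → ℝ) (hann : ∀ k, 0 ≤ a k)
    (happrox : ∀ k : ℕ,
      ∫ ω, |X 0 ω - (μ[X 0 | sigmaIcc Z (-(k : ℤ)) (k : ℤ)]) ω| ∂μ ≤ a k)
    (hXint : Integrable (X 0) μ) (hmean : ∫ ω, X 0 ω ∂μ = 0)
    (hX4 : Integrable (fun ω => X 0 ω ^ 4) μ) (ρ : ℕ → ℝ) (hρ0 : ∀ m, 0 ≤ ρ m)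
    (hρs : Summable fun m : ℕ => (m : ℝ) ^ 2 * ρ m)
    (hρ : ∀ m, ∃ N : ℝ, 1 ≤ N ∧
      16 * ∫ ω, tailR N (X 0 ω) ∂μ + 8 * N ^ 3 * a m + N ^ 4 * betaMix μ Z m ≤ ρ m) :
    ∃ C : ℝ, 0 < C ∧ ∀ n : ℕ,
      ∫ ω, (∑ t ∈ Finset.Icc 1 n, X (t : ℤ) ω) ^ 4 ∂μ ≤ C * (n : ℝ) ^ 2 := by
  have hX0 : ∀ ω, X 0 ω = f (fun k => Z k ω) := fun ω => by rw [hX]; simp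
  have hXm : ∀ u, Measurable (X u) := fun u => by
    have : X u = fun ω => f (fun k => Z (k + u) ω) := funext (hX u)
    rw [this]
    exact hf.comp (measurable_shiftZ Z hZ u)
  have hi4 : ∀ u, Integrable (fun ω => X u ω ^ 4) μ := fun u => by
    simp_rw [hX u]
    simp_rw [hX0] at hX4
    exact stat_integrable μ Z hZ hstat (fun z => f z ^ 4) (by fun_prop) u hX4
  have hmean' : ∀ u, ∫ ω, X u ω ∂μ = 0 := fun u => by
    rw [← hmean]
    simp_rw [hX u, hX0]
    exact stat_integral μ Z hZ hstat f hf u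
  have key : ∀ (m : ℕ) (e : Fin 4 → Bool) (t : Fin 4 → ℤ) (s : Finset (Fin 4)) (L T : ℤ), L ≤ T →
      (∀ i ∈ s, L ≤ t i ∧ t i ≤ T) → (∀ i ∉ s, T + 3 * m ≤ t i) →
      |∫ ω, ∏ i, fac X e t i ω ∂μ
      - (∫ ω, ∏ i ∈ s, fac X e t i ω ∂μ) * (∫ ω, ∏ i ∈ sᶜ, fac X e t i ω ∂μ)| ≤ ρ m := by
    intro m e t s L T hLT h1 h2
    obtain ⟨N, hN, hNρ⟩ := hρ m
    exact (X_split μ Z hZ hstat f hf X hX m (a m) (hann m) (happrox m) hXint hX4 N hN e t s L T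
      hLT h1 h2).trans hNρ
  have pair : ∀ u v : ℕ, u ≤ v → |∫ ω, X u ω * X v ω ∂μ| ≤ ρ ((v - u) / 3) := by
    intro u v huv
    have := key ((v - u) / 3) ![true, true, false, false] ![(u : ℤ), v, v, v] {0} u u le_rfl
      (by simp) (by
        intro i hi
        have : (u : ℤ) + 3 * ((v - u) / 3 : ℕ) ≤ v := by omega
        fin_cases i
        · simp at hi
        · exact this
        · exact this
        · exact this)
    simpa [Fin.prod_univ_four, fac, hmean'] using this
  let F : (Fin 4 → ℕ) → ℝ := fun t => |∫ ω, ∏ i, X (t i) ω ∂μ|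
  let r : ℕ → ℝ := fun g => ρ (g / 3)
  have hr : ∀ g, 0 ≤ r g := fun g => hρ0 _
  have hF : ∀ t : Fin 4 → ℕ, Monotone t →
      F t ≤ kerG r (t 1 - t 0) (t 2 - t 1) (t 3 - t 2) := by
    intro t ht
    have a1 := ht (show (0 : Fin 4) ≤ 1 by decide)
    have a2 := ht (show (1 : Fin 4) ≤ 2 by decide)
    have a3 := ht (show (2 : Fin 4) ≤ 3 by decide)
    have hk := fun m s L T => key m (fun _ => true) (fun i => (t i : ℤ)) s L T
    simp only [fac, if_true] at hk
    have n1 := mul_nonneg (hr (t 1 - t 0)) (mul_nonneg (uInd_nonneg (t 1 - t 0) (t 2 - t 1))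
      (uInd_nonneg (t 1 - t 0) (t 3 - t 2)))
    have n2 := mul_nonneg (hr (t 2 - t 1)) (mul_nonneg (uInd_nonneg (t 2 - t 1) (t 1 - t 0))
      (uInd_nonneg (t 2 - t 1) (t 3 - t 2)))
    have n3 := mul_nonneg (hr (t 3 - t 2)) (mul_nonneg (uInd_nonneg (t 3 - t 2) (t 1 - t 0))
      (uInd_nonneg (t 3 - t 2) (t 2 - t 1)))
    have n4 := mul_nonneg (hr (t 1 - t 0)) (hr (t 3 - t 2))
    by_cases c1 : t 2 - t 1 ≤ t 1 - t 0 ∧ t 3 - t 2 ≤ t 1 - t 0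
    · have := hk ((t 1 - t 0) / 3) {0} (t 0) (t 0) le_rfl (by simp) (by
        intro i hi
        fin_cases i
        · simp at hi
        · change (t 0 : ℤ) + _ ≤ t 1; omega
        · change (t 0 : ℤ) + _ ≤ t 2; omega
        · change (t 0 : ℤ) + _ ≤ t 3; omega)
      simp only [Finset.prod_singleton, hmean', zero_mul, sub_zero] at this
      have e1 : r (t 1 - t 0) * (uInd (t 1 - t 0) (t 2 - t 1) * uInd (t 1 - t 0) (t 3 - t 2))
          = ρ ((t 1 - t 0) / 3) := by simp [uInd, c1.1, c1.2, r]
      unfold kerG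
      show |∫ ω, ∏ i, X (t i) ω ∂μ| ≤ _
      linarith
    by_cases c3 : t 1 - t 0 ≤ t 3 - t 2 ∧ t 2 - t 1 ≤ t 3 - t 2
    · have := hk ((t 3 - t 2) / 3) {0, 1, 2} (t 0) (t 2) (by omega) (by
        intro i hi
        fin_cases i
        · change (t 0 : ℤ) ≤ t 0 ∧ (t 0 : ℤ) ≤ t 2; omega
        · change (t 0 : ℤ) ≤ t 1 ∧ (t 1 : ℤ) ≤ t 2; omega
        · change (t 0 : ℤ) ≤ t 2 ∧ (t 2 : ℤ) ≤ t 2; omega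
        · simp at hi) (by
        intro i hi
        fin_cases i
        · simp at hi
        · simp at hi
        · simp at hi
        · change (t 2 : ℤ) + _ ≤ t 3; omega)
      rw [show ({0, 1, 2} : Finset (Fin 4))ᶜ = {3} by decide] at this
      simp only [Finset.prod_singleton, hmean', mul_zero, sub_zero] at this
      have e1 : r (t 3 - t 2) * (uInd (t 3 - t 2) (t 1 - t 0) * uInd (t 3 - t 2) (t 2 - t 1))
          = ρ ((t 3 - t 2) / 3) := by simp [uInd, c3.1, c3.2, r]
      unfold kerG
      show |∫ ω, ∏ i, X (t i) ω ∂μ| ≤ _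
      linarith
    have c2 : t 1 - t 0 ≤ t 2 - t 1 ∧ t 3 - t 2 ≤ t 2 - t 1 := by omega
    have := hk ((t 2 - t 1) / 3) {0, 1} (t 0) (t 1) (by omega) (by
        intro i hi
        fin_cases i
        · change (t 0 : ℤ) ≤ t 0 ∧ (t 0 : ℤ) ≤ t 1; omega
        · change (t 0 : ℤ) ≤ t 1 ∧ (t 1 : ℤ) ≤ t 1; omega
        · simp at hi
        · simp at hi) (by
        intro i hi
        fin_cases i
        · simp at hi
        · simp at hi
        · change (t 1 : ℤ) + _ ≤ t 2; omega
        · change (t 1 : ℤ) + _ ≤ t 3; omega)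
    rw [show ({0, 1} : Finset (Fin 4))ᶜ = {2, 3} by decide] at this
    simp only [Finset.prod_pair (show (0 : Fin 4) ≠ 1 by decide),
      Finset.prod_pair (show (2 : Fin 4) ≠ 3 by decide)] at this
    have p1 := pair (t 0) (t 1) a1
    have p2 := pair (t 2) (t 3) a3
    have p3 : |(∫ ω, X (t 0) ω * X (t 1) ω ∂μ) * ∫ ω, X (t 2) ω * X (t 3) ω ∂μ|
        ≤ r (t 1 - t 0) * r (t 3 - t 2) := by
      rw [abs_mul]
      exact mul_le_mul p1 p2 (abs_nonneg _) (hr _)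
    have e1 : r (t 2 - t 1) * (uInd (t 2 - t 1) (t 1 - t 0) * uInd (t 2 - t 1) (t 3 - t 2))
          = ρ ((t 2 - t 1) / 3) := by simp [uInd, c2.1, c2.2, r]
    have p4 := abs_sub_abs_le_abs_sub (∫ ω, ∏ i, X (t i) ω ∂μ)
      ((∫ ω, X (t 0) ω * X (t 1) ω ∂μ) * ∫ ω, X (t 2) ω * X (t 3) ω ∂μ)
    unfold kerG
    show |∫ ω, ∏ i, X (t i) ω ∂μ| ≤ _
    linarith
  have hsymm : ∀ (t : Fin 4 → ℕ) (σ : Equiv.Perm (Fin 4)), F (t ∘ σ) = F t := by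
    intro t σ
    show |∫ ω, ∏ i, X (t (σ i)) ω ∂μ| = |∫ ω, ∏ i, X (t i) ω ∂μ|
    simp_rw [fun ω => Equiv.prod_comp σ (fun i => X (t i) ω)]
  have hsum : Summable fun g : ℕ => ((g : ℝ) + 1) ^ 2 * r g := summable_r ρ hρ0 hρs
  have hfin := sum_all_le F (fun t => abs_nonneg _) hsymm r hr hsum hF
  set R := ∑' g : ℕ, ((g : ℝ) + 1) ^ 2 * r g with hR
  have hR0 : 0 ≤ R := tsum_nonneg fun g => mul_nonneg (by positivity) (hr g)
  refine ⟨24 * (3 * R + R ^ 2) + 1, by positivity, fun n => ?_⟩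
  have e : ∫ ω, (∑ t ∈ Finset.Icc 1 n, X (t : ℤ) ω) ^ 4 ∂μ
      = ∑ t ∈ Fintype.piFinset (fun _ : Fin 4 => Finset.Icc 1 n), ∫ ω, ∏ i, X (t i) ω ∂μ := by
    rw [← integral_finsetSum _ fun t _ => integrable_prod4 μ (fun i => X (t i)) (fun i => hXm _)
      (fun i => hi4 _)]
    congr 1
    ext ω
    exact Finset.sum_pow' _ (fun t : ℕ => X (t : ℤ) ω) 4
  rw [e]
  have h1 : ∑ t ∈ Fintype.piFinset (fun _ : Fin 4 => Finset.Icc 1 n), ∫ ω, ∏ i, X (t i) ω ∂μ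
      ≤ ∑ t ∈ Fintype.piFinset (fun _ : Fin 4 => Finset.Icc 1 n), F t :=
    Finset.sum_le_sum fun t _ => le_abs_self _
  have h2 := hfin n
  nlinarith [sq_nonneg (n : ℝ)]

lemma tailR_moment {δ N : ℝ} (hδ : 0 < δ) (hN : 0 < N) (x : ℝ) :
    tailR N x ≤ (1 / N) ^ δ * |x| ^ (4 + δ) := by
  unfold tailR
  split_ifs with h
  · have hx : 0 < |x| := hN.trans h
    have e : x ^ 4 = (1 / |x|) ^ δ * |x| ^ (4 + δ) := by
      rw [Real.rpow_add hx, Real.div_rpow zero_le_one hx.le, Real.one_rpow]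
      have := Real.rpow_pos_of_pos hx δ
      field_simp
      rw [show (4 : ℝ) = ((4 : ℕ) : ℝ) by norm_num, Real.rpow_natCast, Even.pow_abs (by decide)]
    rw [e]
    gcongr
  · positivity

lemma pow4_le {δ : ℝ} (hδ : 0 < δ) (x : ℝ) : x ^ 4 ≤ 1 + |x| ^ (4 + δ) := by
  have h := tailR_moment hδ one_pos x
  unfold tailR at h
  have h0 : 0 ≤ |x| ^ (4 + δ) := by positivity
  split_ifs at h with h1
  · simp at h; linarith
  · have : |x| ^ 4 ≤ 1 := pow_le_one₀ (abs_nonneg x) (not_lt.1 h1)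
    rw [Even.pow_abs (by decide)] at this
    linarith

lemma div_pow_le {b η p δ : ℝ} (k : ℕ) (hk : (k : ℝ) = p) (hδ : 0 < δ) (hb : 0 ≤ b) (hη : 0 < η)
    (h : b ^ (1 / (p + δ)) ≤ η) : (1 / η) ^ k * b ≤ b ^ (δ / (p + δ)) := by
  have hp : 0 ≤ p := hk ▸ Nat.cast_nonneg k
  rcases hb.eq_or_lt with rfl | hb'
  · rw [mul_zero]; positivity
  · have h1 : (b ^ (1 / (p + δ))) ^ k = b ^ (p / (p + δ)) := by
      rw [← Real.rpow_natCast, ← Real.rpow_mul hb, hk]; congr 1; ring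
    have h2 : b = b ^ (p / (p + δ)) * b ^ (δ / (p + δ)) := by
      rw [← Real.rpow_add hb', ← add_div, div_self (by positivity), Real.rpow_one]
    have h3 : b ^ (p / (p + δ)) ≤ η ^ k := by
      rw [← h1]; gcongr
    rw [one_div, inv_pow, inv_mul_le_iff₀ (by positivity)]
    calc b = b ^ (p / (p + δ)) * b ^ (δ / (p + δ)) := h2
      _ ≤ _ := by gcongr

end MainPart

section CondPart

lemma cond_two (K : ℝ) (hK : 0 ≤ K) (τ : ℝ → ℝ) (hτ0 : ∀ N, 0 ≤ τ N) (δ : ℝ) (hδ : 0 < δ)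
    (hτ : ∀ N, 0 < N → τ N ≤ (1 / N) ^ δ * K) (a β : ℕ → ℝ) (ha : ∀ k, 0 ≤ a k) (hb : ∀ k, 0 ≤ β k)
    (ta : Tendsto a atTop (nhds 0)) (tb : Tendsto β atTop (nhds 0)) (d : ℕ)
    (hs : Summable (fun k : ℕ => ((d + k : ℕ) : ℝ) ^ 2 *
              (a (d + k) ^ (δ / (3 + δ)) + β (d + k) ^ (δ / (4 + δ))))) :
    ∃ ρ : ℕ → ℝ, (∀ m, 0 ≤ ρ m) ∧ (Summable fun m : ℕ => (m : ℝ) ^ 2 * ρ m) ∧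
      ∀ m, ∃ N : ℝ, 1 ≤ N ∧ 16 * τ N + 8 * N ^ 3 * a m + N ^ 4 * β m ≤ ρ m := by
  let c : ℕ → ℝ := fun m => (1 / ((m : ℝ) + 1) ^ 4) ^ (1 / δ)
  have hc0 : ∀ m, 0 < c m := fun m => by
    show 0 < (1 / ((m : ℝ) + 1) ^ 4) ^ (1 / δ)
    positivity
  have hcδ : ∀ m, c m ^ δ = 1 / ((m : ℝ) + 1) ^ 4 := fun m => by
    show ((1 / ((m : ℝ) + 1) ^ 4) ^ (1 / δ)) ^ δ = _
    rw [← Real.rpow_mul (by positivity), one_div_mul_cancel hδ.ne', Real.rpow_one]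
  have hc1 : ∀ m, c m ≤ 1 := fun m => by
    refine Real.rpow_le_one (by positivity) ?_ (by positivity)
    rw [div_le_one (by positivity)]
    exact one_le_pow₀ (by linarith [Nat.cast_nonneg (α := ℝ) m])
  let η : ℕ → ℝ := fun m => max (max (a m ^ (1 / (3 + δ))) (β m ^ (1 / (4 + δ)))) (c m)
  have hη0 : ∀ m, 0 < η m := fun m => lt_max_of_lt_right (hc0 m)
  let N : ℕ → ℝ := fun m => max 1 (1 / η m)
  have hN1 : ∀ m, 1 ≤ N m := fun m => le_max_left _ _
  have hρ0 : ∀ m, 0 ≤ 16 * τ (N m) + 8 * N m ^ 3 * a m + N m ^ 4 * β m := fun m => by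
    have h1 := hτ0 (N m)
    have h2 := ha m
    have h3 := hb m
    have h4 := hN1 m
    positivity
  refine ⟨fun m => 16 * τ (N m) + 8 * N m ^ 3 * a m + N m ^ 4 * β m, hρ0, ?_,
    fun m => ⟨N m, hN1 m, le_rfl⟩⟩
  have hs1 : Summable (fun m : ℕ => (m : ℝ) ^ 2 * (a m ^ (δ / (3 + δ)) + β m ^ (δ / (4 + δ)))) := by
    rw [← summable_nat_add_iff d]
    simpa only [add_comm d] using hs
  have hs2 : Summable (fun m : ℕ => (m : ℝ) ^ 2 * (1 / ((m : ℝ) + 1) ^ 4)) := by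
    have h := (summable_nat_add_iff 1).2 (Real.summable_one_div_nat_pow.2 (show 1 < 2 by norm_num))
    refine h.of_nonneg_of_le (fun m => by positivity) fun m => ?_
    push_cast
    rw [mul_one_div, div_le_div_iff₀ (by positivity) (by positivity)]
    have hm := Nat.cast_nonneg (α := ℝ) m
    have : (m : ℝ) ^ 2 ≤ ((m : ℝ) + 1) ^ 2 := by gcongr; linarith
    calc (m : ℝ) ^ 2 * ((m : ℝ) + 1) ^ 2 ≤ ((m : ℝ) + 1) ^ 2 * ((m : ℝ) + 1) ^ 2 := by gcongr
      _ = _ := by ring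
  refine Summable.of_norm_bounded_eventually_nat
    ((hs1.mul_left (16 * K + 8)).add (hs2.mul_left (16 * K))) ?_
  filter_upwards [ta.eventually (ge_mem_nhds one_pos), tb.eventually (ge_mem_nhds one_pos)]
    with m h1 h2
  have hη1 : η m ≤ 1 := max_le (max_le (Real.rpow_le_one (ha m) h1 (by positivity))
    (Real.rpow_le_one (hb m) h2 (by positivity))) (hc1 m)
  have hN : N m = 1 / η m := max_eq_right (by rw [le_div_iff₀ (hη0 m)]; linarith)
  have e1 := div_pow_le (p := 3) 3 (by norm_num) hδ (ha m) (hη0 m)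
    ((le_max_left _ _).trans (le_max_left _ _))
  have e2 := div_pow_le (p := 4) 4 (by norm_num) hδ (hb m) (hη0 m)
    ((le_max_right _ _).trans (le_max_left _ _))
  have A0 : 0 ≤ a m ^ (δ / (3 + δ)) := Real.rpow_nonneg (ha m) _
  have B0 : 0 ≤ β m ^ (δ / (4 + δ)) := Real.rpow_nonneg (hb m) _
  have C0 : 0 ≤ 1 / ((m : ℝ) + 1) ^ 4 := by positivity
  have e3 : η m ^ δ ≤ a m ^ (δ / (3 + δ)) + β m ^ (δ / (4 + δ)) + 1 / ((m : ℝ) + 1) ^ 4 := by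
    have q1 : (a m ^ (1 / (3 + δ))) ^ δ = a m ^ (δ / (3 + δ)) := by
      rw [← Real.rpow_mul (ha m)]; congr 1; ring
    have q2 : (β m ^ (1 / (4 + δ))) ^ δ = β m ^ (δ / (4 + δ)) := by
      rw [← Real.rpow_mul (hb m)]; congr 1; ring
    have q3 := hcδ m
    show (max (max (a m ^ (1 / (3 + δ))) (β m ^ (1 / (4 + δ)))) (c m)) ^ δ ≤ _
    rcases max_choice (max (a m ^ (1 / (3 + δ))) (β m ^ (1 / (4 + δ)))) (c m) with h | h <;> rw [h]
    · rcases max_choice (a m ^ (1 / (3 + δ))) (β m ^ (1 / (4 + δ))) with h | h <;> rw [h]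
      · linarith
      · linarith
    · linarith
  have e4 := hτ (N m) (by linarith [hN1 m])
  rw [hN, one_div_one_div] at e4
  have e5 := mul_le_mul_of_nonneg_right e3 hK
  rw [Real.norm_eq_abs, abs_of_nonneg (mul_nonneg (by positivity) (hρ0 m)), hN]
  have e6 : 16 * τ (1 / η m) + 8 * (1 / η m) ^ 3 * a m + (1 / η m) ^ 4 * β m ≤
      (16 * K + 8) * (a m ^ (δ / (3 + δ)) + β m ^ (δ / (4 + δ)))
        + 16 * K * (1 / ((m : ℝ) + 1) ^ 4) := by
    nlinarith
  have := mul_le_mul_of_nonneg_left e6 (sq_nonneg (m : ℝ))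
  linarith

end CondPart

/-- fourth-moment bound for partial sums: For a centered 1-approximating
functional of a stationary absolutely regular process, under (i) boundedness and
`Σ_{k≥d} k²(a_k+β_k) < ∞`, or (ii) `E|X_0|^{4+δ} < ∞` and
`Σ_{k≥d} k²(a_k^{δ/(3+δ)}+β_k^{δ/(4+δ)}) < ∞`, there is `C > 0` with `E S_n⁴ ≤ C n²`. -/
theorem stmt_14 {Ω : Type*} [MeasurableSpace Ω] (μ : Measure Ω) [IsProbabilityMeasure μ]
    (Z : ℤ → Ω → ℝ) (hZmeas : ∀ t, Measurable (Z t)) (hstat : Stationary μ Z)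
    (β : ℕ → ℝ) (hβ : ∀ k, β k = betaMix μ Z k) (hreg : Tendsto β atTop (nhds 0))
    (f : (ℤ → ℝ) → ℝ) (hf : Measurable f)
    (X : ℤ → Ω → ℝ) (hX : ∀ t ω, X t ω = f (fun k => Z (t + k) ω))
    (a : ℕ → ℝ) (ha0 : Tendsto a atTop (nhds 0)) (hann : ∀ k, 0 ≤ a k)
    (happrox : ∀ k : ℕ,
      ∫ ω, |X 0 ω - (μ[X 0 | sigmaIcc Z (-(k : ℤ)) (k : ℤ)]) ω| ∂μ ≤ a k)
    (hXint : Integrable (X 0) μ) (hmean : ∫ ω, X 0 ω ∂μ = 0)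
    (d : ℕ)
    (hcond :
      ((∃ Mb : ℝ, ∀ᵐ ω ∂μ, |X 0 ω| ≤ Mb)
          ∧ Summable (fun k : ℕ => ((d + k : ℕ) : ℝ) ^ 2 * (a (d + k) + β (d + k))))
      ∨ (∃ δ : ℝ, 0 < δ
          ∧ Integrable (fun ω => |X 0 ω| ^ ((4 : ℝ) + δ)) μ
          ∧ Summable (fun k : ℕ => ((d + k : ℕ) : ℝ) ^ 2 *
              (a (d + k) ^ (δ / (3 + δ)) + β (d + k) ^ (δ / (4 + δ)))))) :
    ∃ C : ℝ, 0 < C ∧ ∀ n : ℕ,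
      ∫ ω, (∑ t ∈ Finset.Icc 1 n, X (t : ℤ) ω) ^ 4 ∂μ ≤ C * (n : ℝ) ^ 2 := by
  have hX' : ∀ t ω, X t ω = f (fun k => Z (k + t) ω) := fun t ω => by
    rw [hX]; congr 1; ext k; rw [add_comm]
  have hX0m : Measurable (X 0) := by
    have : X 0 = fun ω => f (fun k => Z (k + 0) ω) := funext (hX' 0)
    rw [this]
    exact hf.comp (measurable_shiftZ Z hZmeas 0)
  have hβ0 : ∀ k, 0 ≤ β k := fun k => by rw [hβ]; exact betaMix_nonneg _ _ _
  rcases hcond with ⟨⟨Mb, hMb⟩, hs⟩ | ⟨δ, hδ, hmom, hs⟩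
  · have hN1 : 1 ≤ max 1 Mb := le_max_left _ _
    have hN0 : 0 ≤ max 1 Mb := by linarith
    have hle : ∀ᵐ ω ∂μ, |X 0 ω| ≤ max 1 Mb := hMb.mono fun ω h => h.trans (le_max_right _ _)
    refine core_bound μ Z hZmeas hstat f hf X hX' a hann happrox hXint hmean ?_
      (fun m => 8 * (max 1 Mb) ^ 3 * a m + (max 1 Mb) ^ 4 * β m) ?_ ?_ ?_
    · refine (integrable_const ((max 1 Mb) ^ 4)).mono' (hX0m.pow_const 4).aestronglyMeasurable ?_
      filter_upwards [hle] with ω h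
      rw [norm_pow, Real.norm_eq_abs]
      gcongr
    · intro m
      have h1 := hann m
      have h2 := hβ0 m
      positivity
    · have hs1 : Summable (fun m : ℕ => (m : ℝ) ^ 2 * (a m + β m)) := by
        rw [← summable_nat_add_iff d]
        simpa only [add_comm d] using hs
      refine (hs1.mul_left (8 * (max 1 Mb) ^ 3 + (max 1 Mb) ^ 4)).of_nonneg_of_le ?_ ?_
      · intro m
        have h1 := hann m
        have h2 := hβ0 m
        positivity
      · intro m
        have h1 := hann m
        have h2 := hβ0 m
        have p3 : 0 ≤ (max 1 Mb) ^ 3 := by positivity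
        have p4 : 0 ≤ (max 1 Mb) ^ 4 := by positivity
        have : 8 * (max 1 Mb) ^ 3 * a m + (max 1 Mb) ^ 4 * β m
            ≤ (8 * (max 1 Mb) ^ 3 + (max 1 Mb) ^ 4) * (a m + β m) := by nlinarith [mul_nonneg p3 h2, mul_nonneg p4 h1]
        have := mul_le_mul_of_nonneg_left this (sq_nonneg (m : ℝ))
        linarith
    · intro m
      refine ⟨max 1 Mb, hN1, ?_⟩
      have : ∫ ω, tailR (max 1 Mb) (X 0 ω) ∂μ = 0 := by
        rw [integral_congr_ae (g := fun _ => (0 : ℝ))]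
        · simp
        · filter_upwards [hle] with ω h
          rw [tailR, if_neg (not_lt.2 h)]
      rw [this, hβ m]
      linarith
  · have hX4 : Integrable (fun ω => X 0 ω ^ 4) μ := by
      refine ((integrable_const (1 : ℝ)).add hmom).mono' (hX0m.pow_const 4).aestronglyMeasurable
        (ae_of_all _ fun ω => ?_)
      rw [Real.norm_eq_abs, abs_of_nonneg (by positivity)]
      exact pow4_le hδ _
    obtain ⟨ρ, h0, h1, h2⟩ := cond_two (∫ ω, |X 0 ω| ^ ((4 : ℝ) + δ) ∂μ)
      (integral_nonneg fun ω => by positivity) (fun N => ∫ ω, tailR N (X 0 ω) ∂μ)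
      (fun N => integral_nonneg fun ω => tailR_nonneg _ _) δ hδ (fun N hN => by
        show ∫ ω, tailR N (X 0 ω) ∂μ ≤ _
        rw [← integral_const_mul]
        refine integral_mono_of_nonneg (ae_of_all _ fun ω => tailR_nonneg _ _)
          (hmom.const_mul _) (ae_of_all _ fun ω => tailR_moment hδ hN _))
      a β hann hβ0 ha0 hreg d hs
    refine core_bound μ Z hZmeas hstat f hf X hX' a hann happrox hXint hmean hX4 ρ h0 h1 fun m => ?_
    obtain ⟨N, hN, hh⟩ := h2 m
    refine ⟨N, hN, ?_⟩
    rw [← hβ m]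
    exact hh
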